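/- Let x⁰, x¹, …, x^l ∈ X be a sequence such that: x⁰ is lexicographically optimal with respect to (f₂,f₁); for each k ∈ {1,…,l}, X^<(x^{k−1}) ≠ ∅ and x^k maximizes s(x', x^{k−1}) over x' ∈ X^<(x^{k−1}); and X^<(x^l) = ∅. Then every x^k (0 ≤ k ≤ l) is supported efficient, and every extreme-supported non-dominated point y ∈ Y_ESN equals f(x^k) for some k ∈ {0,…,l}. -/

import Mathlib

open Set

noncomputable section

/-- The weighted-sum objective `λ·f₁ + (1−λ)·f₂`. -/
def wsum {X : Type*} (f₁ f₂ : X → ℝ) (lam : ℝ) (x : X) : ℝ :=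
  lam * f₁ x + (1 - lam) * f₂ x

/-- `XlamSet f₁ f₂ λ` is the set `X_λ` of minimizers of the weighted-sum scalarisation. -/
def XlamSet {X : Type*} (f₁ f₂ : X → ℝ) (lam : ℝ) : Set X :=
  {x | ∀ x' : X, wsum f₁ f₂ lam x ≤ wsum f₁ f₂ lam x'}

/-- `x` is supported efficient if it is optimal for some `λ ∈ (0,1)`. -/
def SuppEff {X : Type*} (f₁ f₂ : X → ℝ) (x : X) : Prop :=
  ∃ lam ∈ Set.Ioo (0 : ℝ) 1, x ∈ XlamSet f₁ f₂ lam

/-- The objSlope `s(x',x)` between the images of `x'` and `x`. -/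
def objSlope {X : Type*} (f₁ f₂ : X → ℝ) (x' x : X) : ℝ :=
  (f₂ x' - f₂ x) / (f₁ x' - f₁ x)

/-- `X^<(x)`: the solutions with strictly smaller first objective value. -/
def Xlt {X : Type*} (f₁ : X → ℝ) (x : X) : Set X := {x' | f₁ x' < f₁ x}

/-- `X^>(x)`: the solutions with strictly larger first objective value. -/
def Xgt {X : Type*} (f₁ : X → ℝ) (x : X) : Set X := {x' | f₁ x < f₁ x'}

open Pointwise

/-- `x` is lexicographically optimal with respect to `(f₂, f₁)`. -/
def LexOpt21 {X : Type*} (f₁ f₂ : X → ℝ) (x : X) : Prop :=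
  (∀ x' : X, f₂ x ≤ f₂ x') ∧ ∀ x' : X, f₂ x' = f₂ x → f₁ x ≤ f₁ x'

/-- The outcome set `f(X) ⊆ ℝ²`. -/
def outcomes {X : Type*} (f₁ f₂ : X → ℝ) : Set (ℝ × ℝ) :=
  Set.range fun x => (f₁ x, f₂ x)

/-- `y` is an extreme-supported non-dominated point: `y = f(x)` for some supported efficient
`x`, and `y` is an extreme point of `conv(f(X)) + ℝ²_{≥0}`. -/
def ESN {X : Type*} (f₁ f₂ : X → ℝ) (y : ℝ × ℝ) : Prop :=
  (∃ x, SuppEff f₁ f₂ x ∧ (f₁ x, f₂ x) = y) ∧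
    y ∈ Set.extremePoints ℝ
      (convexHull ℝ (outcomes f₁ f₂) + {p : ℝ × ℝ | 0 ≤ p.1 ∧ 0 ≤ p.2})

/-- `x` minimizes `f₂ + m f₁`. -/
def SMin {X : Type*} (f₁ f₂ : X → ℝ) (m : ℝ) (x : X) : Prop :=
  ∀ x', f₂ x + m * f₁ x ≤ f₂ x' + m * f₁ x'

lemma suppEff_of_SMin {X : Type*} {f₁ f₂ : X → ℝ} {m : ℝ} {x : X} (hm : 0 < m)
    (h : SMin f₁ f₂ m x) : SuppEff f₁ f₂ x := by
  have h1 : 0 < 1 + m := by linarith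
  refine ⟨m / (1 + m), ⟨by positivity, by rw [div_lt_one h1]; linarith⟩, ?_⟩
  intro x'
  have e : ∀ z, wsum f₁ f₂ (m / (1 + m)) z = (f₂ z + m * f₁ z) / (1 + m) := by
    intro z
    unfold wsum
    field_simp
    ring
  rw [e, e]
  exact div_le_div_of_nonneg_right (h x') h1.le

lemma SMin_of_suppEff {X : Type*} {f₁ f₂ : X → ℝ} {x : X}
    (h : SuppEff f₁ f₂ x) : ∃ m, 0 < m ∧ SMin f₁ f₂ m x := by
  obtain ⟨t, ⟨ht0, ht1⟩, hx⟩ := h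
  have h1 : 0 < 1 - t := by linarith
  refine ⟨t / (1 - t), by positivity, ?_⟩
  intro x'
  have e : ∀ z, f₂ z + t / (1 - t) * f₁ z = wsum f₁ f₂ t z / (1 - t) := by
    intro z
    unfold wsum
    field_simp
    ring
  rw [e, e]
  exact div_le_div_of_nonneg_right (hx x') h1.le

lemma step_SMin {X : Type*} {f₁ f₂ : X → ℝ} {m : ℝ} {a b : X} (hm : 0 ≤ m)
    (ha : SMin f₁ f₂ m a) (heq : ∀ x', f₁ x' = f₁ a → f₂ a ≤ f₂ x')
    (hlt : ∀ x', f₁ x' < f₁ a → f₂ a < f₂ x')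
    (hb : f₁ b < f₁ a)
    (hmax : ∀ x' ∈ Xlt f₁ a, objSlope f₁ f₂ x' a ≤ objSlope f₁ f₂ b a) :
    ∃ m', 0 < m' ∧ SMin f₁ f₂ m' a ∧ SMin f₁ f₂ m' b := by
  have hs : objSlope f₁ f₂ b a * (f₁ b - f₁ a) = f₂ b - f₂ a := by
    unfold objSlope
    exact div_mul_cancel₀ _ (by linarith)
  set s := objSlope f₁ f₂ b a with hsdef
  have hneg : 0 < -s := by
    have := hlt b hb
    by_contra hc
    nlinarith
  have hms : m ≤ -s := by
    have := ha b
    by_contra hc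
    nlinarith
  have hA : SMin f₁ f₂ (-s) a := by
    intro x'
    rcases lt_trichotomy (f₁ x') (f₁ a) with h | h | h
    · have h2 := hmax x' h
      unfold objSlope at h2
      rw [div_le_iff_of_neg (by linarith)] at h2
      linarith
    · have := heq x' h
      rw [h]; linarith
    · have := ha x'
      nlinarith
  refine ⟨-s, hneg, hA, ?_⟩
  intro x'
  have := hA x'
  linarith

lemma SMin_f2_eq {X : Type*} {f₁ f₂ : X → ℝ} {m m' : ℝ} {a b : X}
    (ha : SMin f₁ f₂ m a) (hb : SMin f₁ f₂ m' b) (h : f₁ a = f₁ b) : f₂ a = f₂ b := by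
  have h1 := ha b
  have h2 := hb a
  rw [h] at h1 h2
  linarith

lemma mem_upper {X : Type*} (f₁ f₂ : X → ℝ) (a : X) : (f₁ a, f₂ a) ∈
    (convexHull ℝ (outcomes f₁ f₂) + {p : ℝ × ℝ | 0 ≤ p.1 ∧ 0 ≤ p.2}) := by
  refine Set.mem_add.2 ⟨_, subset_convexHull ℝ _ ⟨a, rfl⟩, (0, 0), ⟨le_rfl, le_rfl⟩, by simp⟩

lemma between_not_extreme {X : Type*} {f₁ f₂ : X → ℝ} {m m' : ℝ} {a b z : X}
    (ha : SMin f₁ f₂ m a) (hb : SMin f₁ f₂ m b) (hz : SMin f₁ f₂ m' z)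
    (h1 : f₁ b < f₁ z) (h2 : f₁ z < f₁ a)
    (hext : (f₁ z, f₂ z) ∈ Set.extremePoints ℝ
      (convexHull ℝ (outcomes f₁ f₂) + {p : ℝ × ℝ | 0 ≤ p.1 ∧ 0 ≤ p.2})) : False := by
  have hd : 0 < f₁ a - f₁ b := by linarith
  obtain ⟨t, ht⟩ : ∃ t, t = (f₁ z - f₁ b) / (f₁ a - f₁ b) := ⟨_, rfl⟩
  have ht' : t * (f₁ a - f₁ b) = f₁ z - f₁ b := by
    rw [ht]; exact div_mul_cancel₀ _ hd.ne'
  have t0 : 0 < t := by rw [ht]; exact div_pos (by linarith) hd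
  have t1 : t < 1 := by rw [ht, div_lt_one hd]; linarith
  have hab : f₂ a + m * f₁ a = f₂ b + m * f₁ b := le_antisymm (ha b) (hb a)
  have e1 : f₁ z = t * f₁ a + (1 - t) * f₁ b := by linarith
  have e2 : f₂ z = t * f₂ a + (1 - t) * f₂ b := by
    apply le_antisymm
    · have p1 := mul_le_mul_of_nonneg_left (hz a) t0.le
      have p2 := mul_le_mul_of_nonneg_left (hz b) (sub_nonneg.2 t1.le)
      have p3 : m' * f₁ z = m' * (t * f₁ a + (1 - t) * f₁ b) := by rw [← e1]
      linarith
    · have p1 := mul_le_mul_of_nonneg_left (ha z) t0.le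
      have p2 := mul_le_mul_of_nonneg_left (hb z) (sub_nonneg.2 t1.le)
      have p3 : m * f₁ z = m * (t * f₁ a + (1 - t) * f₁ b) := by rw [← e1]
      linarith
  have := (mem_extremePoints.1 hext).2 _ (mem_upper f₁ f₂ a) _ (mem_upper f₁ f₂ b)
    ⟨t, 1 - t, t0, by linarith, by ring, by
      ext
      · simp [e1]
      · simp [e2]⟩
  have := congrArg Prod.fst this.1
  simp at this
  linarith

/-- If `x⁰` is lexicographically optimal w.r.t. `(f₂,f₁)`, each `x^k`
(`1 ≤ k ≤ l`) maximizes the slope `s(·, x^{k−1})` over `X^<(x^{k−1}) ≠ ∅`, and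
`X^<(x^l) = ∅`, then every `x^k` is supported efficient and every extreme-supported
non-dominated point is the image of some `x^k`. -/
theorem global_algorithm_correct
    {X : Type*} [Fintype X] [Nonempty X] (f₁ f₂ : X → ℝ)
    (l : ℕ) (x : ℕ → X)
    (h0 : LexOpt21 f₁ f₂ (x 0))
    (hstep : ∀ k, 1 ≤ k → k ≤ l →
      x k ∈ Xlt f₁ (x (k - 1)) ∧
        ∀ x' ∈ Xlt f₁ (x (k - 1)),
          objSlope f₁ f₂ x' (x (k - 1)) ≤ objSlope f₁ f₂ (x k) (x (k - 1)))
    (hend : Xlt f₁ (x l) = ∅) :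
    (∀ k ≤ l, SuppEff f₁ f₂ (x k)) ∧
    ∀ y : ℝ × ℝ, ESN f₁ f₂ y → ∃ k ≤ l, (f₁ (x k), f₂ (x k)) = y := by
  have edge : ∀ k, k + 1 ≤ l →
      ∃ m, 0 < m ∧ SMin f₁ f₂ m (x k) ∧ SMin f₁ f₂ m (x (k + 1)) := by
    intro k
    induction k with
    | zero =>
      intro hk
      obtain ⟨hb, hmax⟩ := hstep 1 le_rfl hk
      refine step_SMin (m := 0) le_rfl (fun x' => by simpa using h0.1 x')
        (fun x' _ => h0.1 x') ?_ hb hmax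
      intro x' hx'
      refine lt_of_le_of_ne (h0.1 x') fun he => ?_
      have := h0.2 x' he.symm
      linarith
    | succ k ih =>
      intro hk
      obtain ⟨m, hm, -, hS⟩ := ih (by omega)
      obtain ⟨hb, hmax⟩ := hstep (k + 1 + 1) (by omega) hk
      refine step_SMin hm.le hS ?_ ?_ hb hmax
      · intro x' hx'
        have := hS x'
        rw [hx'] at this
        linarith
      · intro x' hx'
        have := hS x'
        nlinarith
  have hmin : ∀ z, f₁ (x l) ≤ f₁ z := by
    intro z
    by_contra hc
    have : z ∈ Xlt f₁ (x l) := lt_of_not_ge hc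
    rw [hend] at this
    exact this
  have hS : ∀ k ≤ l, ∃ m, 0 < m ∧ SMin f₁ f₂ m (x k) := by
    intro k hk
    rcases Nat.lt_or_ge k l with h | h
    · obtain ⟨m, hm, h1, -⟩ := edge k h
      exact ⟨m, hm, h1⟩
    · obtain rfl : k = l := le_antisymm hk h
      cases k with
      | zero =>
        refine ⟨1, one_pos, fun z => ?_⟩
        have := hmin z
        have := h0.1 z
        linarith
      | succ k =>
        obtain ⟨m, hm, -, h1⟩ := edge k le_rfl
        exact ⟨m, hm, h1⟩
  refine ⟨fun k hk => ?_, ?_⟩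
  · obtain ⟨m, hm, h⟩ := hS k hk
    exact suppEff_of_SMin hm h
  · rintro y ⟨⟨z, hz, rfl⟩, hext⟩
    obtain ⟨m, hm, hz⟩ := SMin_of_suppEff hz
    by_contra hno
    have hne : ∀ k ≤ l, f₁ (x k) ≠ f₁ z := by
      intro k hk he
      obtain ⟨m', hm', h⟩ := hS k hk
      have he2 := SMin_f2_eq h hz he
      exact hno ⟨k, hk, by rw [he, he2]⟩
    have key : ∀ k ≤ l, f₁ z ≤ f₁ (x k) := by
      intro k
      induction k with
      | zero =>
        intro _
        have h1 := hz (x 0)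
        have h2 := h0.1 z
        exact le_of_mul_le_mul_left (by linarith) hm
      | succ k ih =>
        intro hk
        have h1 := lt_of_le_of_ne (ih (by omega)) (hne k (by omega)).symm
        by_contra hc
        obtain ⟨m', hm', ha, hb⟩ := edge k hk
        exact between_not_extreme ha hb hz (lt_of_not_ge hc) h1 hext
    exact hne l le_rfl (le_antisymm (hmin z) (key l le_rfl))
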